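/- Let n ≥ 1 and let Ĥ : ℝ^{2n} → ℝ be continuous, convex, positively 2-homogeneous, smooth on ℝ^{2n} ∖ {0}, with Ĥ(z) ≥ m‖z‖² for some m > 0. Let γ̂ : ℝ → ℝ^{2n} ∖ {0} be a smooth 1-periodic solution of γ̂'(t) = J₀∇Ĥ(γ̂(t)) and set A := ½∫₀¹ ω₀(γ̂(t),γ̂'(t)) dt, so that A = ∫₀¹ Ĥ(γ̂(t)) dt > 0. Let θ > 1 and c ∈ ℝ, and let K : ℝ × ℝ^{2n} → ℝ be continuous, 1-periodic in the first variable, with K(t,z) ≥ θ·Ĥ(z) − c for all (t,z). Then for every s ≥ 0: ∫₀¹ K*(t, −s·J₀γ̂'(t)) dt ≤ (1/θ)·A·s² + c, where K*(t,w) := sup_{z}(⟨z,w⟩ − K(t,z)); consequently the Clarke dual action values Ψ(s) := −A·s² + ∫₀¹ K*(t, −s·J₀γ̂'(t)) dt satisfy Ψ(s) ≤ (1/θ − 1)·A·s² + c for all s ≥ 0 and Ψ(s) → −∞ as s → +∞. In particular, the Clarke dual action functional of K is unbounded from below. -/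

import Mathlib

open Metric Set
open scoped InnerProductSpace

noncomputable section

/-- The standard complex structure `J₀(x₁,y₁,…,xₙ,yₙ) = (−y₁,x₁,…,−yₙ,xₙ)` on `ℝ^{2n}`. -/
def J0 (n : ℕ) (z : EuclideanSpace ℝ (Fin (2 * n))) : EuclideanSpace ℝ (Fin (2 * n)) :=
  WithLp.toLp 2 fun i : Fin (2 * n) =>
    if h : (i : ℕ) % 2 = 0 then -z ⟨(i : ℕ) + 1, by have := i.isLt; omega⟩
    else z ⟨(i : ℕ) - 1, by have := i.isLt; omega⟩

/-- The standard symplectic form `ω₀(u,v) = ⟨J₀u, v⟩` on `ℝ^{2n}`. -/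
def omega0 (n : ℕ) (u v : EuclideanSpace ℝ (Fin (2 * n))) : ℝ := ⟪J0 n u, v⟫_ℝ

end


def sig10 (n : ℕ) (i : Fin (2 * n)) : Fin (2 * n) :=
  if h : (i : ℕ) % 2 = 0 then ⟨(i : ℕ) + 1, by have := i.isLt; omega⟩
    else ⟨(i : ℕ) - 1, by have := i.isLt; omega⟩

lemma sig10_invol (n : ℕ) : Function.Involutive (sig10 n) := by
  intro i
  unfold sig10
  apply Fin.ext
  by_cases h : (i : ℕ) % 2 = 0
  · have h2 : ¬ ((i : ℕ) + 1) % 2 = 0 := by omega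
    simp [h, h2]
  · have h2 : ((i : ℕ) - 1) % 2 = 0 := by omega
    simp [h, h2]
    omega

lemma J0_inner (n : ℕ) (u v : EuclideanSpace ℝ (Fin (2 * n))) :
    ⟪J0 n u, J0 n v⟫_ℝ = ⟪u, v⟫_ℝ := by
  rw [PiLp.inner_apply, PiLp.inner_apply]
  rw [← Equiv.sum_comp (sig10_invol n).toPerm (fun i => ⟪u i, v i⟫_ℝ)]
  apply Finset.sum_congr rfl
  intro i _
  simp only [Function.Involutive.coe_toPerm, J0, sig10]
  split_ifs <;> simp

lemma J0_J0 (n : ℕ) (u : EuclideanSpace ℝ (Fin (2 * n))) : J0 n (J0 n u) = -u := by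
  ext i
  by_cases h : (i : ℕ) % 2 = 0
  · have h2 : ¬ ((i : ℕ) + 1) % 2 = 0 := by omega
    simp [J0, h, h2]
  · have h2 : ((i : ℕ) - 1) % 2 = 0 := by omega
    have h3 : (i : ℕ) - 1 + 1 = i := by omega
    simp [J0, h, h2, h3]

lemma euler10 {E : Type*} [NormedAddCommGroup E] [InnerProductSpace ℝ E] [CompleteSpace E]
    (H : E → ℝ) (hhom : ∀ r : ℝ, 0 ≤ r → ∀ z, H (r • z) = r ^ 2 * H z) (w g : E)
    (hg : HasGradientAt H g w) : ⟪g, w⟫_ℝ = 2 * H w := by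
  have h1 : HasDerivAt (fun r : ℝ => H (r • w)) (⟪g, w⟫_ℝ) 1 := by
    have hl : HasDerivAt (fun r : ℝ => r • w) w 1 := by
      simpa using (hasDerivAt_id (1 : ℝ)).smul_const w
    have hf := hg.hasFDerivAt
    rw [← one_smul ℝ w] at hf
    have := hf.comp_hasDerivAt (1 : ℝ) hl
    simpa [Function.comp_def] using this
  have h2 : HasDerivAt (fun r : ℝ => r ^ 2 * H w) (2 * H w) 1 := by
    simpa using (hasDerivAt_pow 2 (1 : ℝ)).mul_const (H w)
  refine h1.unique (h2.congr_of_eventuallyEq ?_)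
  filter_upwards [lt_mem_nhds (zero_lt_one : (0 : ℝ) < 1)] with r hr
  exact hhom r hr.le w

lemma convgrad10 {E : Type*} [NormedAddCommGroup E] [InnerProductSpace ℝ E] [CompleteSpace E]
    (H : E → ℝ) (hconv : ConvexOn ℝ Set.univ H) (w g u : E)
    (hg : HasGradientAt H g w) : H w + ⟪g, u - w⟫_ℝ ≤ H u := by
  have hc : ConvexOn ℝ Set.univ (fun r : ℝ => H (AffineMap.lineMap w u r)) := by
    simpa [Function.comp_def] using hconv.comp_affineMap (AffineMap.lineMap w u : ℝ →ᵃ[ℝ] E)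
  have hd : HasDerivAt (fun r : ℝ => H (AffineMap.lineMap w u r)) (⟪g, u - w⟫_ℝ) 0 := by
    have hl : HasDerivAt (fun r : ℝ => (AffineMap.lineMap w u r : E)) (u - w) 0 :=
      AffineMap.hasDerivAt_lineMap
    have hf := hg.hasFDerivAt
    rw [← AffineMap.lineMap_apply_zero (k := ℝ) w u] at hf
    have := hf.comp_hasDerivAt (0 : ℝ) hl
    simpa [Function.comp_def] using this
  have := hc.le_slope_of_hasDerivAt (mem_univ 0) (mem_univ 1) zero_lt_one hd
  simp [slope] at this
  linarith

/-- The Clarke dual action functional of a Hamiltonian `K ≥ θ·Ĥ − c`, with `θ > 1` and `Ĥ`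
positively 2-homogeneous, is unbounded from below along the rescaled closed characteristic
`s·γ̂`:  `∫₀¹K*(t, −s·J₀γ̂'(t))dt ≤ (1/θ)·A·s² + c`, hence
`Ψ(s) ≤ (1/θ − 1)·A·s² + c → −∞` as `s → ∞`. -/
theorem stmt10 (n : ℕ) (hn : 1 ≤ n)
    (Hhat : EuclideanSpace ℝ (Fin (2 * n)) → ℝ)
    (hcont : Continuous Hhat)
    (hconv : ConvexOn ℝ Set.univ Hhat)
    (hhom : ∀ r : ℝ, 0 ≤ r → ∀ z, Hhat (r • z) = r ^ 2 * Hhat z)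
    (hsmooth : ContDiffOn ℝ (⊤ : ℕ∞) Hhat {z : EuclideanSpace ℝ (Fin (2 * n)) | z ≠ 0})
    (m : ℝ) (hm : 0 < m)
    (hlow : ∀ z, m * ‖z‖ ^ 2 ≤ Hhat z)
    (γ : ℝ → EuclideanSpace ℝ (Fin (2 * n)))
    (hγ0 : ∀ t, γ t ≠ 0)
    (hγsm : ContDiff ℝ (⊤ : ℕ∞) γ)
    (hγsol : ∀ t, HasDerivAt γ (J0 n (gradient Hhat (γ t))) t)
    (hγper : Function.Periodic γ 1)
    (A : ℝ)
    (hA : A = (1 / 2) * ∫ t in (0 : ℝ)..1, omega0 n (γ t) (deriv γ t))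
    (θ c : ℝ) (hθ : 1 < θ)
    (K : ℝ → EuclideanSpace ℝ (Fin (2 * n)) → ℝ)
    (hKcont : Continuous (fun p : ℝ × EuclideanSpace ℝ (Fin (2 * n)) => K p.1 p.2))
    (hKper : ∀ t z, K (t + 1) z = K t z)
    (hKlow : ∀ t z, θ * Hhat z - c ≤ K t z) :
    (A = ∫ t in (0 : ℝ)..1, Hhat (γ t)) ∧ 0 < A ∧
    (∀ s : ℝ, 0 ≤ s →
      (∫ t in (0 : ℝ)..1, ⨆ z, (⟪z, -(s • J0 n (deriv γ t))⟫_ℝ - K t z)) ≤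
        (1 / θ) * A * s ^ 2 + c) ∧
    (∀ s : ℝ, 0 ≤ s →
      (-A * s ^ 2 + ∫ t in (0 : ℝ)..1, ⨆ z, (⟪z, -(s • J0 n (deriv γ t))⟫_ℝ - K t z)) ≤
        (1 / θ - 1) * A * s ^ 2 + c) ∧
    Filter.Tendsto
      (fun s : ℝ =>
        -A * s ^ 2 + ∫ t in (0 : ℝ)..1, ⨆ z, (⟪z, -(s • J0 n (deriv γ t))⟫_ℝ - K t z))
      Filter.atTop Filter.atBot := by
  have hgrad : ∀ t, HasGradientAt Hhat (gradient Hhat (γ t)) (γ t) := by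
    intro t
    have h1 : ContDiffAt ℝ (⊤ : ℕ∞) Hhat (γ t) :=
      hsmooth.contDiffAt (isOpen_ne.mem_nhds (hγ0 t))
    exact (h1.differentiableAt (by simp)).hasGradientAt
  have hder : ∀ t, deriv γ t = J0 n (gradient Hhat (γ t)) := fun t => (hγsol t).deriv
  have hE : ∀ t, ⟪gradient Hhat (γ t), γ t⟫_ℝ = 2 * Hhat (γ t) := fun t =>
    euler10 Hhat hhom _ _ (hgrad t)
  have hHγc : Continuous (fun t => Hhat (γ t)) := hcont.comp hγsm.continuous
  have hAeq : A = ∫ t in (0 : ℝ)..1, Hhat (γ t) := by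
    have : ∀ t, omega0 n (γ t) (deriv γ t) = 2 * Hhat (γ t) := by
      intro t
      rw [omega0, hder, J0_inner, real_inner_comm, hE]
    rw [hA]
    simp_rw [this]
    rw [intervalIntegral.integral_const_mul]
    ring
  have hApos : 0 < A := by
    rw [hAeq]
    refine intervalIntegral.intervalIntegral_pos_of_pos (hHγc.intervalIntegrable _ _) ?_ one_pos
    intro t
    have := norm_pos_iff.mpr (hγ0 t)
    exact lt_of_lt_of_le (by positivity) (hlow (γ t))
  have hH0 : ∀ z, 0 ≤ Hhat z := fun z => le_trans (by positivity) (hlow z)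
  have hθ0 : 0 < θ := by linarith
  have hpt : ∀ s : ℝ, 0 ≤ s → ∀ t z, ⟪z, -(s • J0 n (deriv γ t))⟫_ℝ - K t z ≤
      s ^ 2 / θ * Hhat (γ t) + c := by
    intro s hs t z
    have e : -(s • J0 n (deriv γ t)) = s • gradient Hhat (γ t) := by
      rw [hder, J0_J0]; simp
    rw [e, real_inner_smul_right, real_inner_comm]
    have hk := hKlow t z
    suffices h : s * ⟪gradient Hhat (γ t), z⟫_ℝ ≤ θ * Hhat z + s ^ 2 / θ * Hhat (γ t) by
      linarith
    rcases hs.eq_or_lt with rfl | hs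
    · have := hH0 z
      simp
      positivity
    · have h1 := convgrad10 Hhat hconv (γ t) _ ((θ / s) • z) (hgrad t)
      rw [inner_sub_right, hE, real_inner_smul_right, hhom _ (by positivity)] at h1
      have h2 : θ / s * ⟪gradient Hhat (γ t), z⟫_ℝ ≤ (θ / s) ^ 2 * Hhat z + Hhat (γ t) := by
        linarith
      have h3 := mul_le_mul_of_nonneg_left h2 (show 0 ≤ s ^ 2 / θ by positivity)
      calc s * ⟪gradient Hhat (γ t), z⟫_ℝ
          = s ^ 2 / θ * (θ / s * ⟪gradient Hhat (γ t), z⟫_ℝ) := by field_simp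
        _ ≤ _ := h3
        _ = _ := by field_simp
  have hdc : Continuous (fun t => J0 n (deriv γ t)) := by
    have h1 : Continuous (deriv γ) := hγsm.continuous_deriv (by simp)
    have h2 : Continuous (J0 n) := by
      unfold J0
      refine (PiLp.continuous_toLp 2 _).comp (continuous_pi fun i => ?_)
      split_ifs <;> fun_prop
    exact h2.comp h1
  have hmain : ∀ s : ℝ, 0 ≤ s →
      (∫ t in (0 : ℝ)..1, ⨆ z, (⟪z, -(s • J0 n (deriv γ t))⟫_ℝ - K t z)) ≤
        (1 / θ) * A * s ^ 2 + c := by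
    intro s hs
    have hbdd : ∀ t, BddAbove (range fun z => ⟪z, -(s • J0 n (deriv γ t))⟫_ℝ - K t z) := by
      intro t
      refine ⟨s ^ 2 / θ * Hhat (γ t) + c, ?_⟩
      rintro _ ⟨z, rfl⟩
      exact hpt s hs t z
    have hup : ∀ t, (⨆ z, (⟪z, -(s • J0 n (deriv γ t))⟫_ℝ - K t z)) ≤
        s ^ 2 / θ * Hhat (γ t) + c := fun t => ciSup_le (hpt s hs t)
    have hdown : ∀ t, - K t 0 ≤ (⨆ z, (⟪z, -(s • J0 n (deriv γ t))⟫_ℝ - K t z)) := by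
      intro t
      refine le_trans ?_ (le_ciSup (hbdd t) 0)
      simp
    have hmeas : Measurable (fun t => ⨆ z, (⟪z, -(s • J0 n (deriv γ t))⟫_ℝ - K t z)) := by
      apply LowerSemicontinuous.measurable
      apply lowerSemicontinuous_ciSup hbdd
      intro z
      apply Continuous.lowerSemicontinuous
      have hk : Continuous fun t => K t z :=
        hKcont.comp (continuous_id.prodMk continuous_const)
      fun_prop
    have hUc : Continuous (fun t => s ^ 2 / θ * Hhat (γ t) + c) := by fun_prop
    have hLc : Continuous fun t => - K t 0 :=
      (hKcont.comp (continuous_id.prodMk continuous_const)).neg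
    have hint : IntervalIntegrable (fun t => ⨆ z, (⟪z, -(s • J0 n (deriv γ t))⟫_ℝ - K t z))
        MeasureTheory.volume 0 1 := by
      refine IntervalIntegrable.mono_fun
        (((hUc.abs).add hLc.abs).intervalIntegrable 0 1) hmeas.aestronglyMeasurable ?_
      refine Filter.Eventually.of_forall fun t => ?_
      have a := hup t
      have b := hdown t
      simp only [Real.norm_eq_abs, Pi.add_apply]
      refine le_trans ?_ (le_abs_self _)
      rw [abs_le]
      have a1 := le_abs_self (s ^ 2 / θ * Hhat (γ t) + c)
      have a2 := abs_nonneg (s ^ 2 / θ * Hhat (γ t) + c)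
      have b1 := neg_abs_le (- K t 0)
      have b2 := abs_nonneg (- K t 0)
      constructor <;> linarith
    refine (intervalIntegral.integral_mono_on zero_le_one hint
      (hUc.intervalIntegrable 0 1) (fun t _ => hup t)).trans ?_
    rw [intervalIntegral.integral_add ((hHγc.const_mul _).intervalIntegrable _ _)
      (by simp), intervalIntegral.integral_const_mul, ← hAeq]
    simp only [intervalIntegral.integral_const, sub_zero, one_smul]
    apply le_of_eq
    ring
  have hmain2 : ∀ s : ℝ, 0 ≤ s →
      (-A * s ^ 2 + ∫ t in (0 : ℝ)..1, ⨆ z, (⟪z, -(s • J0 n (deriv γ t))⟫_ℝ - K t z)) ≤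
        (1 / θ - 1) * A * s ^ 2 + c := by
    intro s hs
    have := hmain s hs
    linarith
  refine ⟨hAeq, hApos, hmain, hmain2, ?_⟩
  have hneg : (1 / θ - 1) * A < 0 := by
    have : 1 / θ < 1 := by rw [div_lt_one hθ0]; exact hθ
    nlinarith
  have hlim : Filter.Tendsto (fun s : ℝ => (1 / θ - 1) * A * s ^ 2 + c)
      Filter.atTop Filter.atBot :=
    Filter.tendsto_atBot_add_const_right _ _
      ((Filter.tendsto_pow_atTop two_ne_zero).const_mul_atTop_of_neg hneg)
  refine Filter.tendsto_atBot_mono' _ ?_ hlim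
  filter_upwards [Filter.eventually_ge_atTop 0] with s hs
  exact hmain2 s hs
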